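/- Let F be an algebraically closed field of characteristic zero, G a finite group with identity e, and W a unitary affine G-graded F-algebra satisfying a nontrivial ordinary polynomial identity. Fix n and t ∈ ℕ. Then the total-degree-t component of R_n^G(W) equals Σ_{s=0}^{t} R_{n,e}^{(t−s)}·B_n^{(s)}: every element of R_n^G(W) that is the image of a span of monomials of total degree t is a sum of products u·v where, for some 0 ≤ s ≤ t, u is (the image of) a polynomial of total degree t−s in the variables x_{1,e},…,x_{n,e} and v ∈ B_n^{(s)}. -/

import Mathlib

open Filter

noncomputable section Defs

variable (F : Type) [Field F] (G : Type) [Group G] (W : Type) [Ring W] [Algebra F W]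

/-- The graded identities of `W` in `n` graded variables: the polynomials in the free
algebra `F⟨x_{i,g} : 1 ≤ i ≤ n, g ∈ G⟩` vanishing under every admissible substitution. -/
def IdU (grading : G → Submodule F W) (n : ℕ) : Submodule F (FreeAlgebra F (Fin n × G)) :=
  ⨅ a : {a : Fin n × G → W // ∀ p : Fin n × G, a p ∈ grading p.2},
    LinearMap.ker (FreeAlgebra.lift F a.1).toLinearMap

/-- The monomial associated to a word in the variables. -/
def monOf {n : ℕ} (l : List (Fin n × G)) : FreeAlgebra F (Fin n × G) :=
  (l.map (FreeAlgebra.ι F)).prod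

/-- The multidegree of a word: the number of occurrences of variables with index `i`. -/
def listDeg {G : Type} {n : ℕ} (l : List (Fin n × G)) : Fin n → ℕ :=
  fun i => (l.map Prod.fst).count i

/-- The span of the monomials of multidegree `α` in the free algebra. -/
def Adeg (n : ℕ) (α : Fin n → ℕ) : Submodule F (FreeAlgebra F (Fin n × G)) :=
  Submodule.span F {x | ∃ l : List (Fin n × G), listDeg l = α ∧ x = monOf F G l}

/-- The multidegree-`α` component of the relatively free algebra `R_n^G(W)`. -/
def RnDeg (grading : G → Submodule F W) (n : ℕ) (α : Fin n → ℕ) :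
    Submodule F (FreeAlgebra F (Fin n × G) ⧸ IdU F G W grading n) :=
  Submodule.map (IdU F G W grading n).mkQ (Adeg F G n α)

/-- The `n`-th `G`-graded codimension of `W`: the dimension of the multilinear
component of the relatively free algebra. -/
def cnG (grading : G → Submodule F W) (n : ℕ) : ℕ :=
  Module.finrank F ↥(RnDeg F G W grading n (fun _ => 1))

/-- `W` satisfies a nontrivial ordinary polynomial identity. -/
def SatisfiesOrdinaryPI : Prop :=
  ∃ f : FreeAlgebra F ℕ, f ≠ 0 ∧ ∀ a : ℕ → W, FreeAlgebra.lift F a f = 0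

/-- Left-normed iterated commutator `[a, b₁, …, b_m]`. -/
def lcomm {R : Type} [NonUnitalNonAssocRing R] : R → List R → R
  | a, [] => a
  | a, b :: l => lcomm (a * b - b * a) l

/-- Left-normed commutator of the elements of a list (junk value `0` on `[]`). -/
def lcommList {R : Type} [NonUnitalNonAssocRing R] : List R → R
  | [] => 0
  | a :: l => lcomm a l

/-- The left-normed commutator of the variables listed in `c`. -/
def commOf {n : ℕ} (c : List (Fin n × G)) : FreeAlgebra F (Fin n × G) :=
  lcommList (c.map (FreeAlgebra.ι F))

/-- The subspace (of the free algebra) of the multidegree-`β` part of `B_n`: spanned by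
products `x_{i₁,h₁}⋯x_{i_r,h_r}·c₁⋯c_m` with all `h_j ≠ e`, each `c_j` a left-normed
commutator of length at least `2` in the variables, of total multidegree `β`. -/
def BUdeg (n : ℕ) (β : Fin n → ℕ) : Submodule F (FreeAlgebra F (Fin n × G)) :=
  Submodule.span F {x | ∃ (pre : List (Fin n × G)) (cs : List (List (Fin n × G))),
    (∀ p ∈ pre, p.2 ≠ (1 : G)) ∧ (∀ c ∈ cs, 2 ≤ c.length) ∧
    listDeg (pre ++ cs.flatten) = β ∧
    x = monOf F G pre * (cs.map (commOf F G)).prod}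

/-- The multidegree-`β` component `B_n^β` of `B_n` inside `R_n^G(W)`. -/
def BnDeg (grading : G → Submodule F W) (n : ℕ) (β : Fin n → ℕ) :
    Submodule F (FreeAlgebra F (Fin n × G) ⧸ IdU F G W grading n) :=
  Submodule.map (IdU F G W grading n).mkQ (BUdeg F G n β)

/-- The span of the monomials of total degree `t` in the free algebra. -/
def AdegTot (n t : ℕ) : Submodule F (FreeAlgebra F (Fin n × G)) :=
  Submodule.span F {x | ∃ l : List (Fin n × G), l.length = t ∧ x = monOf F G l}

/-- The total-degree-`s` part `B_n^{(s)}` of `B_n`, inside the free algebra. -/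
def BUtot (n s : ℕ) : Submodule F (FreeAlgebra F (Fin n × G)) :=
  Submodule.span F {x | ∃ (pre : List (Fin n × G)) (cs : List (List (Fin n × G))),
    (∀ p ∈ pre, p.2 ≠ (1 : G)) ∧ (∀ c ∈ cs, 2 ≤ c.length) ∧
    (pre ++ cs.flatten).length = s ∧
    x = monOf F G pre * (cs.map (commOf F G)).prod}

/-- The span of the degree-`d` monomials in the identity-component variables
`x_{1,e}, …, x_{n,e}` (so `R_{n,e}^{(d)}` upstairs in the free algebra). -/
def ReDeg (n d : ℕ) : Submodule F (FreeAlgebra F (Fin n × G)) :=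
  Submodule.span F {x | ∃ l : List (Fin n × G),
    (∀ p ∈ l, p.2 = (1 : G)) ∧ l.length = d ∧ x = monOf F G l}

end Defs

section SpanningByCommutators

variable {F : Type} [Field F] {G : Type} {n : ℕ}

lemma lcomm_append_singleton {R : Type} [NonUnitalNonAssocRing R] (a b : R) (l : List R) :
    lcomm a (l ++ [b]) = lcomm a l * b - b * lcomm a l := by
  induction l generalizing a with
  | nil => rfl
  | cons c l ih => exact ih _

lemma monOf_append (l m : List (Fin n × G)) :
    monOf F G (l ++ m) = monOf F G l * monOf F G m := by
  simp [monOf]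

lemma monOf_singleton (p : Fin n × G) : monOf F G [p] = FreeAlgebra.ι F p := by
  simp [monOf]

lemma commOf_append_singleton {c : List (Fin n × G)} (hc : c ≠ []) (p : Fin n × G) :
    commOf F G (c ++ [p]) =
      commOf F G c * FreeAlgebra.ι F p - FreeAlgebra.ι F p * commOf F G c := by
  cases c with
  | nil => exact absurd rfl hc
  | cons a c =>
    simp only [commOf, List.map_append, List.map_cons, List.cons_append, lcommList, List.map_nil]
    exact lcomm_append_singleton _ _ _

variable (F G) in
/-- The span of the products of left-normed commutators of length at least `2` in the variables,
of total degree `k`. -/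
def commProdSpan (n k : ℕ) : Submodule F (FreeAlgebra F (Fin n × G)) :=
  Submodule.span F {x | ∃ cs : List (List (Fin n × G)),
    (∀ c ∈ cs, 2 ≤ c.length) ∧ cs.flatten.length = k ∧ x = (cs.map (commOf F G)).prod}

lemma prod_commOf_mem {cs : List (List (Fin n × G))} (hcs : ∀ c ∈ cs, 2 ≤ c.length) :
    (cs.map (commOf F G)).prod ∈ commProdSpan F G n cs.flatten.length :=
  Submodule.subset_span ⟨cs, hcs, rfl, rfl⟩

lemma commProdSpan_mul_le (j k : ℕ) :
    commProdSpan F G n j * commProdSpan F G n k ≤ commProdSpan F G n (j + k) := by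
  rw [commProdSpan, commProdSpan, Submodule.span_mul_span, Submodule.span_le]
  rintro _ ⟨_, ⟨cs, hcs, rfl, rfl⟩, _, ⟨ds, hds, rfl, rfl⟩, rfl⟩
  refine Submodule.subset_span ⟨cs ++ ds, ?_, by simp, by simp⟩
  simp only [List.mem_append]
  rintro c (h | h)
  exacts [hcs c h, hds c h]

lemma commOf_mem {c : List (Fin n × G)} (hc : 2 ≤ c.length) :
    commOf F G c ∈ commProdSpan F G n c.length :=
  Submodule.subset_span ⟨[c], by simpa using hc, by simp, by simp⟩

/-- The commutator of a product of left-normed commutators with a variable is a sum of such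
products. -/
lemma prod_commOf_bracket_mem {cs : List (List (Fin n × G))} (hcs : ∀ c ∈ cs, 2 ≤ c.length)
    (p : Fin n × G) :
    (cs.map (commOf F G)).prod * FreeAlgebra.ι F p - FreeAlgebra.ι F p * (cs.map (commOf F G)).prod
      ∈ commProdSpan F G n (cs.flatten.length + 1) := by
  induction cs with
  | nil => simp
  | cons c cs ih =>
    have hc : 2 ≤ c.length := hcs c (by simp)
    have hcs' : ∀ d ∈ cs, 2 ≤ d.length := fun d hd => hcs d (by simp [hd])
    have h1 := commProdSpan_mul_le _ _ (Submodule.mul_mem_mul (commOf_mem (F := F) hc) (ih hcs'))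
    have h2 := commProdSpan_mul_le _ _ (Submodule.mul_mem_mul
      (commOf_mem (F := F) (c := c ++ [p]) (by simp; omega)) (prod_commOf_mem (F := F) hcs'))
    rw [commOf_append_singleton (by rintro rfl; simp at hc)] at h2
    have e1 : c.length + (cs.flatten.length + 1) = (c :: cs).flatten.length + 1 := by
      simp; omega
    have e2 : (c ++ [p]).length + cs.flatten.length = (c :: cs).flatten.length + 1 := by
      simp; omega
    rw [e1] at h1
    rw [e2] at h2
    convert add_mem h1 h2 using 1
    simp only [List.map_cons, List.prod_cons]
    noncomm_ring

lemma commOf_mem_AdegTot {c : List (Fin n × G)} (hc : c ≠ []) :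
    commOf F G c ∈ AdegTot F G n c.length := by
  induction c using List.reverseRecOn with
  | nil => exact absurd rfl hc
  | append_singleton c p ih =>
    by_cases h : c = []
    · subst h
      exact Submodule.subset_span ⟨[p], rfl, by simp [monOf, commOf, lcommList, lcomm]⟩
    · rw [commOf_append_singleton h]
      refine sub_mem ?_ ?_
      · refine (Submodule.map_span_le (LinearMap.mulRight F (FreeAlgebra.ι F p)) _ _).2 ?_
          (Submodule.mem_map_of_mem (ih h))
        rintro _ ⟨l, hl, rfl⟩
        exact Submodule.subset_span ⟨l ++ [p], by simp [hl], by simp [monOf]⟩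
      · refine (Submodule.map_span_le (LinearMap.mulLeft F (FreeAlgebra.ι F p)) _ _).2 ?_
          (Submodule.mem_map_of_mem (ih h))
        rintro _ ⟨l, hl, rfl⟩
        exact Submodule.subset_span ⟨p :: l, by simp [hl], by simp [monOf]⟩

lemma AdegTot_mul_le (j k : ℕ) : AdegTot F G n j * AdegTot F G n k ≤ AdegTot F G n (j + k) := by
  rw [AdegTot, AdegTot, Submodule.span_mul_span, Submodule.span_le]
  rintro _ ⟨_, ⟨l, rfl, rfl⟩, _, ⟨m, rfl, rfl⟩, rfl⟩
  exact Submodule.subset_span ⟨l ++ m, by simp, (monOf_append l m).symm⟩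

lemma prod_commOf_mem_AdegTot {cs : List (List (Fin n × G))} (hcs : ∀ c ∈ cs, 2 ≤ c.length) :
    (cs.map (commOf F G)).prod ∈ AdegTot F G n cs.flatten.length := by
  induction cs with
  | nil => exact Submodule.subset_span ⟨[], rfl, by simp [monOf]⟩
  | cons c cs ih =>
    have hc : c ≠ [] := by
      rintro rfl
      simpa using hcs [] (by simp)
    have h := AdegTot_mul_le _ _ (Submodule.mul_mem_mul (commOf_mem_AdegTot (F := F) hc)
      (ih fun d hd => hcs d (by simp [hd])))
    simpa using h

variable [Group G]

lemma ReDeg_le_AdegTot (d : ℕ) : ReDeg F G n d ≤ AdegTot F G n d :=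
  Submodule.span_mono fun _ ⟨l, _, hl, hx⟩ => ⟨l, hl, hx⟩

lemma BUtot_le_AdegTot (s : ℕ) : BUtot F G n s ≤ AdegTot F G n s := by
  rw [BUtot, Submodule.span_le]
  rintro _ ⟨pre, cs, _, hcs, rfl, rfl⟩
  rw [List.length_append]
  exact AdegTot_mul_le _ _ (Submodule.mul_mem_mul (Submodule.subset_span ⟨pre, rfl, rfl⟩)
    (prod_commOf_mem_AdegTot hcs))

lemma ReDeg_mul_BUtot_le_AdegTot (d s : ℕ) :
    ReDeg F G n d * BUtot F G n s ≤ AdegTot F G n (d + s) :=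
  (mul_le_mul' (ReDeg_le_AdegTot d) (BUtot_le_AdegTot s)).trans (AdegTot_mul_le d s)

lemma BUtot_mul_commProdSpan_le (s k : ℕ) :
    BUtot F G n s * commProdSpan F G n k ≤ BUtot F G n (s + k) := by
  rw [BUtot, commProdSpan, Submodule.span_mul_span, Submodule.span_le]
  rintro _ ⟨_, ⟨pre, cs, hpre, hcs, rfl, rfl⟩, _, ⟨ds, hds, rfl, rfl⟩, rfl⟩
  refine Submodule.subset_span ⟨pre, cs ++ ds, hpre, ?_, by simp [add_assoc], by simp [mul_assoc]⟩
  simp only [List.mem_append]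
  rintro c (h | h)
  exacts [hcs c h, hds c h]

lemma monOf_mem_BUtot {pre : List (Fin n × G)} (hpre : ∀ p ∈ pre, p.2 ≠ 1) :
    monOf F G pre ∈ BUtot F G n pre.length :=
  Submodule.subset_span ⟨pre, [], hpre, by simp, by simp, by simp⟩

/-- `BUtot` is stable under right multiplication by variables outside the identity component. -/
lemma mul_ι_mem_BUtot {s : ℕ} {x : FreeAlgebra F (Fin n × G)} (hx : x ∈ BUtot F G n s)
    {p : Fin n × G} (hp : p.2 ≠ 1) : x * FreeAlgebra.ι F p ∈ BUtot F G n (s + 1) := by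
  refine (Submodule.map_span_le (LinearMap.mulRight F (FreeAlgebra.ι F p)) _ _).2 ?_
    (Submodule.mem_map_of_mem hx)
  rintro _ ⟨pre, cs, hpre, hcs, rfl, rfl⟩
  rw [LinearMap.mulRight_apply]
  have hpre' : ∀ q ∈ pre ++ [p], q.2 ≠ 1 := by
    simp only [List.mem_append, List.mem_singleton]
    rintro q (h | rfl)
    exacts [hpre q h, hp]
  have h1 := BUtot_mul_commProdSpan_le _ _ (Submodule.mul_mem_mul
    (monOf_mem_BUtot (F := F) hpre) (prod_commOf_bracket_mem (F := F) hcs p))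
  have h2 := BUtot_mul_commProdSpan_le _ _ (Submodule.mul_mem_mul
    (monOf_mem_BUtot (F := F) hpre') (prod_commOf_mem (F := F) hcs))
  rw [monOf_append, monOf_singleton] at h2
  have e1 : pre.length + (cs.flatten.length + 1) = (pre ++ cs.flatten).length + 1 := by
    rw [List.length_append]; omega
  have e2 : (pre ++ [p]).length + cs.flatten.length = (pre ++ cs.flatten).length + 1 := by
    simp only [List.length_append, List.length_singleton]; omega
  rw [e1] at h1
  rw [e2] at h2
  convert add_mem h1 h2 using 1
  noncomm_ring

lemma monOf_bracket_mem_BUtot {pre : List (Fin n × G)} (hpre : ∀ q ∈ pre, q.2 ≠ 1)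
    (p : Fin n × G) :
    monOf F G pre * FreeAlgebra.ι F p - FreeAlgebra.ι F p * monOf F G pre
      ∈ BUtot F G n (pre.length + 1) := by
  induction pre using List.reverseRecOn with
  | nil => simp [monOf]
  | append_singleton pre q ih =>
    have hpre' : ∀ q ∈ pre, q.2 ≠ 1 := fun r hr => hpre r (by simp [hr])
    have h1 := mul_ι_mem_BUtot (ih hpre') (hpre q (by simp))
    have h2 := BUtot_mul_commProdSpan_le _ _ (Submodule.mul_mem_mul
      (monOf_mem_BUtot (F := F) hpre') (commOf_mem (F := F) (c := [q, p]) le_rfl))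
    have e : pre.length + [q, p].length = pre.length + 1 + 1 := rfl
    rw [e] at h2
    rw [List.length_append, List.length_singleton]
    convert add_mem h1 h2 using 1
    simp only [monOf_append, monOf_singleton, commOf, lcommList, lcomm, List.map_cons, List.map_nil]
    noncomm_ring

lemma bracket_mem_BUtot {s : ℕ} {x : FreeAlgebra F (Fin n × G)} (hx : x ∈ BUtot F G n s)
    (p : Fin n × G) :
    x * FreeAlgebra.ι F p - FreeAlgebra.ι F p * x ∈ BUtot F G n (s + 1) := by
  refine (Submodule.map_span_le (LinearMap.mulRight F (FreeAlgebra.ι F p) -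
    LinearMap.mulLeft F (FreeAlgebra.ι F p)) _ _).2 ?_ (Submodule.mem_map_of_mem hx)
  rintro _ ⟨pre, cs, hpre, hcs, rfl, rfl⟩
  rw [LinearMap.sub_apply, LinearMap.mulRight_apply, LinearMap.mulLeft_apply]
  have h1 := BUtot_mul_commProdSpan_le _ _ (Submodule.mul_mem_mul
    (monOf_mem_BUtot (F := F) hpre) (prod_commOf_bracket_mem (F := F) hcs p))
  have h2 := BUtot_mul_commProdSpan_le _ _ (Submodule.mul_mem_mul
    (monOf_bracket_mem_BUtot (F := F) hpre p) (prod_commOf_mem (F := F) hcs))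
  have e1 : pre.length + (cs.flatten.length + 1) = (pre ++ cs.flatten).length + 1 := by
    rw [List.length_append]; omega
  have e2 : pre.length + 1 + cs.flatten.length = (pre ++ cs.flatten).length + 1 := by
    rw [List.length_append]; omega
  rw [e1] at h1
  rw [e2] at h2
  convert add_mem h1 h2 using 1
  noncomm_ring

/-- Every word lies in the sum of the products of words in identity-component variables with
elements of `BUtot`. -/
lemma monOf_mem_iSup (l : List (Fin n × G)) :
    monOf F G l ∈ ⨆ q : {q : ℕ × ℕ // q.1 + q.2 = l.length},
      ReDeg F G n q.1.1 * BUtot F G n q.1.2 := by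
  induction l using List.reverseRecOn with
  | nil =>
    refine Submodule.mem_iSup_of_mem ⟨(0, 0), rfl⟩ ?_
    rw [← mul_one (monOf F G [])]
    exact Submodule.mul_mem_mul (Submodule.subset_span ⟨[], by simp, rfl, rfl⟩)
      (Submodule.subset_span ⟨[], [], by simp, by simp, rfl, by simp [monOf]⟩)
  | append_singleton l p ih =>
    rw [monOf_append, monOf_singleton, List.length_append, List.length_singleton]
    have key : ∀ q : {q : ℕ × ℕ // q.1 + q.2 = l.length},
        ReDeg F G n q.1.1 * BUtot F G n q.1.2 ≤
          (⨆ q : {q : ℕ × ℕ // q.1 + q.2 = l.length + 1},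
            ReDeg F G n q.1.1 * BUtot F G n q.1.2).comap
              (LinearMap.mulRight F (FreeAlgebra.ι F p)) := by
      rintro ⟨⟨d, s⟩, hds⟩
      rw [Submodule.mul_le]
      intro u hu v hv
      rw [Submodule.mem_comap, LinearMap.mulRight_apply]
      dsimp only at hds hu hv
      have mem_right : ∀ w ∈ BUtot F G n (s + 1), u * w ∈
          ⨆ q : {q : ℕ × ℕ // q.1 + q.2 = l.length + 1},
            ReDeg F G n q.1.1 * BUtot F G n q.1.2 := fun w hw =>
        Submodule.mem_iSup_of_mem ⟨(d, s + 1), by dsimp only; omega⟩ (Submodule.mul_mem_mul hu hw)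
      by_cases hp : p.2 = 1
      · have hup : u * FreeAlgebra.ι F p ∈ ReDeg F G n (d + 1) := by
          refine (Submodule.map_span_le (LinearMap.mulRight F (FreeAlgebra.ι F p)) _ _).2 ?_
            (Submodule.mem_map_of_mem hu)
          rintro _ ⟨a, ha, rfl, rfl⟩
          refine Submodule.subset_span ⟨a ++ [p], ?_, by simp, by simp [monOf]⟩
          simp only [List.mem_append, List.mem_singleton]
          rintro q (h | rfl)
          exacts [ha q h, hp]
        have h1 := Submodule.mem_iSup_of_mem
          (p := fun q : {q : ℕ × ℕ // q.1 + q.2 = l.length + 1} =>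
            ReDeg F G n q.1.1 * BUtot F G n q.1.2)
          ⟨(d + 1, s), by dsimp only; omega⟩ (Submodule.mul_mem_mul hup hv)
        convert add_mem h1 (mem_right _ (bracket_mem_BUtot hv p)) using 1
        noncomm_ring
      · rw [mul_assoc]
        exact mem_right _ (mul_ι_mem_BUtot hv hp)
    exact iSup_le key ih

lemma AdegTot_eq_sum (t : ℕ) :
    AdegTot F G n t = ∑ s ∈ Finset.range (t + 1), ReDeg F G n (t - s) * BUtot F G n s := by
  refine le_antisymm ?_ ?_
  · rw [AdegTot, Submodule.span_le]
    rintro _ ⟨l, rfl, rfl⟩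
    refine SetLike.le_def.1 (iSup_le ?_) (monOf_mem_iSup l)
    rintro ⟨⟨d, s⟩, hds⟩
    dsimp only at hds ⊢
    obtain rfl : d = l.length - s := by omega
    exact Finset.single_le_sum (f := fun s => ReDeg F G n (l.length - s) * BUtot F G n s)
      (fun _ _ => bot_le) (Finset.mem_range.2 (by omega))
  · refine Finset.sum_induction _ (· ≤ AdegTot F G n t) (fun _ _ => sup_le) bot_le ?_
    intro s hs
    have h := ReDeg_mul_BUtot_le_AdegTot (F := F) (G := G) (n := n) (t - s) s
    rwa [Nat.sub_add_cancel (Nat.lt_succ_iff.1 (Finset.mem_range.1 hs))] at h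

end SpanningByCommutators

theorem stmt13 {F G W : Type} [Field F] [IsAlgClosed F] [CharZero F]
    [Group G] [Finite G] [DecidableEq G]
    [Ring W] [Algebra F W]
    (grading : G → Submodule F W)
    (hdecomp : DirectSum.IsInternal grading)
    (hgmul : ∀ (g h : G), ∀ a ∈ grading g, ∀ b ∈ grading h, a * b ∈ grading (g * h))
    (hone : (1 : W) ∈ grading 1)
    (haffine : ∃ S : Finset W, Algebra.adjoin F (S : Set W) = ⊤)
    (hPI : SatisfiesOrdinaryPI F W)
    (n t : ℕ) :
    Submodule.map (IdU F G W grading n).mkQ (AdegTot F G n t) =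
      ∑ s ∈ Finset.range (t + 1),
        Submodule.map (IdU F G W grading n).mkQ (ReDeg F G n (t - s) * BUtot F G n s) := by
  rw [AdegTot_eq_sum]
  induction Finset.range (t + 1) using Finset.induction_on with
  | empty => simp
  | insert s S hs ih =>
    rw [Finset.sum_insert hs, Finset.sum_insert hs, ← ih, Submodule.add_eq_sup, Submodule.map_sup,
      Submodule.add_eq_sup]
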